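/- arXiv:math/0406312 — 2 statements merged into one kernel-verified Lean document; each statement's English description precedes it below -/
import Mathlib

section
/- The coefficient η_3 satisfies η_3 = γ_0⁴ − 4γ_0²γ_1 + 2γ_1² + 4γ_0γ_2 − 4γ_3. -/
open Filter Topology Finset

/-- A power series that converges near `0` has an analytic sum, whose Taylor coefficients are
those of the series. -/
lemma analyticAt_tsum_mul_pow {a : ℕ → ℂ}
    (ha : ∀ᶠ s in 𝓝[≠] (0 : ℂ), Summable fun m : ℕ => a m * s ^ m) :
    AnalyticAt ℂ (fun s => ∑' m : ℕ, a m * s ^ m) 0 ∧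
      ∀ n : ℕ, iteratedDeriv n (fun s => ∑' m : ℕ, a m * s ^ m) 0 = n.factorial * a n := by
  have hp : HasFPowerSeriesAt (fun s => ∑' m : ℕ, a m * s ^ m)
      (FormalMultilinearSeries.ofScalars ℂ a) 0 := by
    rw [hasFPowerSeriesAt_iff]
    filter_upwards [eventually_nhdsWithin_iff.mp ha] with s hs
    have hsum : Summable fun m : ℕ => a m * s ^ m := by
      rcases eq_or_ne s 0 with rfl | h
      · exact summable_of_ne_finset_zero (s := {0}) fun m hm => by simp_all
      · exact hs h
    simpa [FormalMultilinearSeries.coeff_ofScalars, mul_comm] using hsum.hasSum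
  have han : AnalyticAt ℂ (fun s => ∑' m : ℕ, a m * s ^ m) 0 := ⟨_, hp⟩
  refine ⟨han, fun n => ?_⟩
  have h := congrArg (fun p => p.coeff n)
    (hp.eq_formalMultilinearSeries han.hasFPowerSeriesAt)
  simp only [FormalMultilinearSeries.coeff_ofScalars] at h
  rw [h, mul_div_cancel₀ _ (by exact_mod_cast n.factorial_ne_zero)]

/-- Comparison of Taylor coefficients in `E * G = -deriv G`, with `eₙ` the coefficients of `E` and
`gₙ` those of `G`. -/
lemma sum_range_mul_eq_of_mul_eq_neg_deriv {E G : ℂ → ℂ} {e g : ℕ → ℂ}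
    (hE : AnalyticAt ℂ E 0) (hG : AnalyticAt ℂ G 0)
    (he : ∀ n : ℕ, iteratedDeriv n E 0 = n.factorial * e n)
    (hg : ∀ n : ℕ, iteratedDeriv n G 0 = n.factorial * g n)
    (h : (fun s => E s * G s) =ᶠ[𝓝[≠] 0] fun s => -deriv G s) (n : ℕ) :
    ∑ i ∈ range (n + 1), e i * g (n - i) = -((n + 1) * g (n + 1)) := by
  have h' : (fun s => E s * G s) =ᶠ[𝓝 0] fun s => -deriv G s :=
    (ContinuousAt.eventuallyEq_nhds_iff_eventuallyEq_nhdsNE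
      (hE.mul hG).continuousAt hG.deriv.neg.continuousAt).mp h
  have hd := h'.iteratedDeriv_eq n
  rw [iteratedDeriv_fun_mul hE.contDiffAt hG.contDiffAt, iteratedDeriv_fun_neg,
    ← iteratedDeriv_succ', hg] at hd
  have hn : (n.factorial : ℂ) ≠ 0 := by exact_mod_cast n.factorial_ne_zero
  apply mul_left_cancel₀ hn
  rw [mul_sum]
  calc ∑ i ∈ range (n + 1), (n.factorial : ℂ) * (e i * g (n - i))
      = ∑ i ∈ range (n + 1), (n.choose i : ℂ) * iteratedDeriv i E 0 *
          iteratedDeriv (n - i) G 0 := by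
        refine sum_congr rfl fun i hi => ?_
        rw [he, hg, ← Nat.choose_mul_factorial_mul_factorial
          (Nat.lt_succ_iff.mp (mem_range.mp hi))]
        push_cast
        ring
    _ = _ := by
        rw [hd, Nat.factorial_succ]
        push_cast
        ring

theorem eta_three (γ η : ℕ → ℂ)
    (hγ : ∀ᶠ s in 𝓝[≠] (0 : ℂ),
      HasSum (fun m : ℕ => γ m * s ^ m) (riemannZeta (s + 1) - 1 / s))
    (hη : ∀ᶠ s in 𝓝[≠] (0 : ℂ),
      HasSum (fun m : ℕ => η m * s ^ m)
        (-(deriv riemannZeta (s + 1)) / riemannZeta (s + 1) - 1 / s)) :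
    η 3 = γ 0 ^ 4 - 4 * γ 0 ^ 2 * γ 1 + 2 * γ 1 ^ 2 + 4 * γ 0 * γ 2 - 4 * γ 3 := by
  let g : ℕ → ℂ := fun m => if m = 0 then 1 else γ (m - 1)
  have hgsum : ∀ᶠ s in 𝓝[≠] (0 : ℂ),
      HasSum (fun m : ℕ => g m * s ^ m) (s * riemannZeta (s + 1)) := by
    filter_upwards [hγ, self_mem_nhdsWithin] with s hs hs0
    have hs0 : s ≠ 0 := hs0
    rw [← hasSum_nat_add_iff' 1]
    have hshift : (fun m : ℕ => g (m + 1) * s ^ (m + 1)) = fun m => s * (γ m * s ^ m) := by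
      ext m
      simp only [g, Nat.add_eq_zero_iff, one_ne_zero, and_false, if_false, add_tsub_cancel_right]
      ring
    have hval : s * riemannZeta (s + 1) - ∑ i ∈ range 1, g i * s ^ i =
        s * (riemannZeta (s + 1) - 1 / s) := by
      simp only [g, sum_range_one, if_true, pow_zero]
      field_simp
    rw [hshift, hval]
    exact hs.mul_left s
  obtain ⟨hE, he⟩ := analyticAt_tsum_mul_pow (hη.mono fun s hs => hs.summable)
  obtain ⟨hG, hg⟩ := analyticAt_tsum_mul_pow (hgsum.mono fun s hs => hs.summable)
  set E : ℂ → ℂ := fun s => ∑' m : ℕ, η m * s ^ m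
  set G : ℂ → ℂ := fun s => ∑' m : ℕ, g m * s ^ m
  have hG0 : G 0 ≠ 0 := by
    have := hg 0
    simp [g] at this
    simp [this]
  have hGne : ∀ᶠ s in 𝓝[≠] (0 : ℂ), G s ≠ 0 :=
    (hG.continuousAt.eventually_ne hG0).filter_mono nhdsWithin_le_nhds
  have hGan : ∀ᶠ s in 𝓝[≠] (0 : ℂ), AnalyticAt ℂ G s :=
    hG.eventually_analyticAt.filter_mono nhdsWithin_le_nhds
  have hζ : ∀ᶠ s in 𝓝[≠] (0 : ℂ), riemannZeta (s + 1) = G s / s := by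
    filter_upwards [hgsum, self_mem_nhdsWithin] with s hs hs0
    have hs0 : s ≠ 0 := hs0
    rw [show G s = _ from hs.tsum_eq, mul_div_cancel_left₀ _ hs0]
  have hEG : (fun s => E s * G s) =ᶠ[𝓝[≠] 0] fun s => -deriv G s := by
    filter_upwards [hη, hζ, eventually_eventually_nhdsWithin.mpr hζ, hGne, hGan,
      self_mem_nhdsWithin] with s hs hζs hζ' hGs hGas hs0
    have hs0 : s ≠ 0 := hs0
    rw [isOpen_compl_singleton.nhdsWithin_eq hs0] at hζ'
    have hder : deriv riemannZeta (s + 1) = (deriv G s * s - G s) / s ^ 2 := by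
      rw [← deriv_comp_add_const, EventuallyEq.deriv_eq hζ',
        deriv_fun_div hGas.differentiableAt differentiableAt_fun_id hs0]
      simp
    rw [show E s = _ from hs.tsum_eq, hder, hζs]
    field_simp
    ring
  have key := sum_range_mul_eq_of_mul_eq_neg_deriv hE hG he hg hEG
  have h0 := key 0
  have h1 := key 1
  have h2 := key 2
  have h3 := key 3
  simp only [sum_range_succ, g] at h0 h1 h2 h3
  norm_num at h0 h1 h2 h3
  have e1 : η 1 = γ 0 ^ 2 - 2 * γ 1 := by linear_combination h1 - γ 0 * h0
  have e2 : η 2 = -γ 0 ^ 3 + 3 * γ 0 * γ 1 - 3 * γ 2 := by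
    linear_combination h2 - γ 1 * h0 - γ 0 * e1
  linear_combination h3 - γ 2 * h0 - γ 1 * e1 - γ 0 * e2
end

section
/- The Stieltjes constant γ_4 satisfies γ_4 = (1/5!)(−η_0⁵ + 10η_0³η_1 − 15η_0η_1² − 20η_0²η_2 + 20η_1η_2 + 30η_0η_3 − 24η_4). -/
open Filter Topology Finset

/-- A power series expansion valid on a punctured neighborhood of `0` is the Taylor series of an
analytic function. -/
lemma exists_analyticAt_of_eventually_hasSum {c : ℕ → ℂ} {f : ℂ → ℂ}
    (h : ∀ᶠ s in 𝓝[≠] (0 : ℂ), HasSum (fun m : ℕ => c m * s ^ m) (f s)) :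
    ∃ g : ℂ → ℂ, AnalyticAt ℂ g 0 ∧ g =ᶠ[𝓝[≠] 0] f ∧
      ∀ k, iteratedDeriv k g 0 = (Nat.factorial k : ℂ) * c k := by
  have hg : HasFPowerSeriesAt (Function.update f 0 (c 0))
      (FormalMultilinearSeries.ofScalars ℂ c) 0 := by
    rw [hasFPowerSeriesAt_iff]
    filter_upwards [eventually_nhdsWithin_iff.1 h] with s hs
    rcases eq_or_ne s 0 with rfl | h0
    · simp only [FormalMultilinearSeries.coeff_ofScalars, smul_eq_mul, add_zero,
        Function.update_self]
      simpa only [pow_zero, one_mul] using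
        hasSum_single (f := fun n : ℕ => (0 : ℂ) ^ n * c n) 0 (by simp +contextual)
    · simpa [FormalMultilinearSeries.coeff_ofScalars, h0, mul_comm] using hs h0
  refine ⟨_, hg.analyticAt, Function.update_eventuallyEq_nhdsNE f 0 0 (c 0), fun k => ?_⟩
  have hk := congrArg (fun p => p.coeff k)
    (hg.eq_formalMultilinearSeries hg.analyticAt.hasFPowerSeriesAt)
  simp only [FormalMultilinearSeries.coeff_ofScalars] at hk
  rw [hk, mul_div_cancel₀ _ (Nat.cast_ne_zero.2 k.factorial_ne_zero)]

lemma hasSum_cons_mul_pow {c : ℕ → ℂ} {a s x : ℂ} (h : HasSum (fun m : ℕ => c m * s ^ m) x) :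
    HasSum (fun m : ℕ => (Nat.casesOn m a c : ℂ) * s ^ m) (a + s * x) := by
  rw [← hasSum_nat_add_iff' 1]
  simpa [pow_succ, mul_comm, mul_left_comm] using h.mul_left s

/-- Leibniz recursion for the Taylor coefficients of a solution of `F' = -F H`. -/
lemma iteratedDeriv_succ_of_deriv_eq_neg_mul {F H : ℂ → ℂ} {z : ℂ} (hF : AnalyticAt ℂ F z)
    (hH : AnalyticAt ℂ H z) (h : deriv F =ᶠ[𝓝 z] -(F * H)) (n : ℕ) :
    iteratedDeriv (n + 1) F z = -∑ i ∈ range (n + 1),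
      n.choose i * iteratedDeriv i F z * iteratedDeriv (n - i) H z := by
  rw [iteratedDeriv_succ', h.iteratedDeriv_eq, iteratedDeriv_neg,
    iteratedDeriv_mul hF.contDiffAt hH.contDiffAt]

theorem gamma_four (γ η : ℕ → ℂ)
    (hγ : ∀ᶠ s in 𝓝[≠] (0 : ℂ),
      HasSum (fun m : ℕ => γ m * s ^ m) (riemannZeta (s + 1) - 1 / s))
    (hη : ∀ᶠ s in 𝓝[≠] (0 : ℂ),
      HasSum (fun m : ℕ => η m * s ^ m)
        (-(deriv riemannZeta (s + 1)) / riemannZeta (s + 1) - 1 / s)) :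
    γ 4 = (1 / ((Nat.factorial 5 : ℕ) : ℂ)) * (-η 0 ^ 5 + 10 * η 0 ^ 3 * η 1 - 15 * η 0 * η 1 ^ 2 - 20 * η 0 ^ 2 * η 2 + 20 * η 1 * η 2 + 30 * η 0 * η 3 - 24 * η 4) := by
  obtain ⟨F, hF, hFζ, hFc⟩ := exists_analyticAt_of_eventually_hasSum
    (hγ.mono fun s hs => hasSum_cons_mul_pow (a := 1) hs)
  obtain ⟨H, hH, hHζ, hHc⟩ := exists_analyticAt_of_eventually_hasSum hη
  have hF0 : F 0 = 1 := by simpa using hFc 0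
  have hF_ne : ∀ᶠ s in 𝓝[≠] (0 : ℂ), F s ≠ 0 :=
    (hF.continuousAt.eventually_ne (by simp [hF0])).filter_mono nhdsWithin_le_nhds
  have hFs : ∀ᶠ s in 𝓝[≠] (0 : ℂ), F s = s * riemannZeta (s + 1) := by
    filter_upwards [hFζ, self_mem_nhdsWithin] with s hs (h0 : s ≠ 0)
    rw [hs]
    field_simp
    ring
  have hode : deriv F =ᶠ[𝓝[≠] 0] -(F * H) := by
    filter_upwards [eventually_eventually_nhdsWithin.2 hFs, hFs, hF_ne, hHζ,
      self_mem_nhdsWithin] with s hs' hs hne hHs (h0 : s ≠ 0)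
    rw [isOpen_compl_singleton.nhdsWithin_eq h0] at hs'
    have hζ : HasDerivAt riemannZeta (deriv riemannZeta (s + 1)) (s + 1) :=
      (differentiableAt_riemannZeta (by simpa using h0)).hasDerivAt
    have hd := (hasDerivAt_id s).mul (hζ.comp_add_const s 1)
    rw [EventuallyEq.deriv_eq hs', Pi.neg_apply, Pi.mul_apply, hs, hHs]
    have hζ_ne : riemannZeta (s + 1) ≠ 0 := by
      rintro h
      simp [hs, h] at hne
    refine hd.deriv.trans ?_
    simp only [id]
    field_simp
    ring
  have hrec := iteratedDeriv_succ_of_deriv_eq_neg_mul hF hH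
    ((hF.deriv.continuousAt.eventuallyEq_nhds_iff_eventuallyEq_nhdsNE
      (hF.mul hH).neg.continuousAt).1 hode)
  simp only [hFc, hHc] at hrec
  have h0 := hrec 0
  have h1 := hrec 1
  have h2 := hrec 2
  have h3 := hrec 3
  have h4 := hrec 4
  simp [sum_range_succ, Nat.factorial, Nat.choose] at h0 h1 h2 h3 h4
  norm_num [Nat.factorial]
  have g1 : γ 1 = (-(η 1) - γ 0 * η 0) / 2 := by linear_combination h1 / 2
  have g2 : γ 2 = (-2 * η 2 - 2 * γ 0 * η 1 - 2 * γ 1 * η 0) / 6 := by linear_combination h2 / 6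
  have g3 : γ 3 = (-6 * η 3 - 6 * γ 0 * η 2 - 6 * γ 1 * η 1 - 6 * γ 2 * η 0) / 24 := by
    linear_combination h3 / 24
  have g4 : γ 4 = (-24 * η 4 - 24 * γ 0 * η 3 - 24 * γ 1 * η 2 - 24 * γ 2 * η 1
      - 24 * γ 3 * η 0) / 120 := by
    linear_combination h4 / 120
  rw [g4, g3, g2, g1, h0]
  ring
end
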